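/- arXiv:2510.26036 — 6 statements merged into one kernel-verified Lean document; each statement's English description precedes it below -/
import Mathlib

section
/- Let E and R be finite sets (edges and routes), let {R_k}_{k=1}^K be a partition of R into nonempty classes (OD pairs), and let d_k > 0 for each k. Define the feasible polytope X = {x ∈ ℝ^R : x_r ≥ 0 for all r, and Σ_{r ∈ R_k} x_r = d_k for each k}. Let δ : E × R → {0, 1} be an incidence function, define edge flows y_e(x) = Σ_{r ∈ R} δ(e, r) x_r, and let each edge cost c_e : ℝ → ℝ be continuous, nonnegative, and monotone nondecreasing on [0, ∞). Let w ∈ ℝ^R be a fixed vector of route charging prices, and define the objective B(x) = Σ_{e ∈ E} ∫₀^{y_e(x)} c_e(ξ) dξ + Σ_{r ∈ R} w_r x_r. Then x* ∈ X minimizes B over X if and only if x* is a user equilibrium: for every k and every pair of routes r, r' ∈ R_k with x*_r > 0, one has Σ_{e ∈ E} δ(e, r) c_e(y_e(x*)) + w_r ≤ Σ_{e ∈ E} δ(e, r') c_e(y_e(x*)) + w_{r'}. -/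
open Finset

/-- Tangent-line inequality for the primitive of a function that is continuous and monotone
on `[0, ∞)`. -/
lemma sub_mul_le_integral_sub_integral {f : ℝ → ℝ} (hcont : ContinuousOn f (Set.Ici 0))
    (hmono : MonotoneOn f (Set.Ici 0)) {a b : ℝ} (ha : 0 ≤ a) (hb : 0 ≤ b) :
    (b - a) * f a ≤ (∫ t in (0 : ℝ)..b, f t) - ∫ t in (0 : ℝ)..a, f t := by
  have hint : ∀ {u v : ℝ}, 0 ≤ u → 0 ≤ v →
      IntervalIntegrable f MeasureTheory.volume u v := fun hu hv =>
    (hcont.mono fun t ht => le_trans (le_min hu hv) ht.1).intervalIntegrable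
  rw [intervalIntegral.integral_interval_sub_left (hint le_rfl hb) (hint le_rfl ha)]
  rcases le_total a b with hab | hab
  · calc (b - a) * f a = ∫ _ in a..b, f a := by simp
      _ ≤ ∫ t in a..b, f t :=
        intervalIntegral.integral_mono_on hab (by simp) (hint ha hb) fun t ht =>
          hmono ha (ha.trans ht.1) ht.1
  · have h : ∫ t in b..a, f t ≤ ∫ _ in b..a, f a :=
      intervalIntegral.integral_mono_on hab (hint hb ha) (by simp) fun t ht =>
        hmono (hb.trans ht.1) ha ht.2
    rw [intervalIntegral.integral_const, smul_eq_mul] at h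
    rw [intervalIntegral.integral_symm]
    linarith

section Beckmann

variable {Edge Route : Type*} [Fintype Edge] [Fintype Route]

/-- The total cost of route `r` at the route flow `x`. -/
def routeCost (δ : Edge → Route → ℝ) (c : Edge → ℝ → ℝ) (w x : Route → ℝ) (r : Route) : ℝ :=
  (∑ e, δ e r * c e (∑ ρ, δ e ρ * x ρ)) + w r

/-- The Beckmann potential of the route flow `x`. -/
noncomputable def beckmann (δ : Edge → Route → ℝ) (c : Edge → ℝ → ℝ) (w x : Route → ℝ) : ℝ :=
  (∑ e, ∫ ξ in (0 : ℝ)..(∑ r, δ e r * x r), c e ξ) + ∑ r, w r * x r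

/-- The route costs form a subgradient of the Beckmann potential. -/
lemma sum_routeCost_mul_sub_le {δ : Edge → Route → ℝ} (hδ : ∀ e r, 0 ≤ δ e r)
    {c : Edge → ℝ → ℝ} (hcont : ∀ e, ContinuousOn (c e) (Set.Ici 0))
    (hmono : ∀ e, MonotoneOn (c e) (Set.Ici 0)) (w : Route → ℝ) {x z : Route → ℝ}
    (hx : ∀ r, 0 ≤ x r) (hz : ∀ r, 0 ≤ z r) :
    ∑ r, routeCost δ c w x r * (z r - x r) ≤ beckmann δ c w z - beckmann δ c w x := by
  have hflow : ∀ {v : Route → ℝ}, (∀ r, 0 ≤ v r) → ∀ e, 0 ≤ ∑ r, δ e r * v r := fun hv e =>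
    sum_nonneg fun r _ => mul_nonneg (hδ e r) (hv r)
  have hedge : ∑ e, ((∑ r, δ e r * z r) - ∑ r, δ e r * x r) * c e (∑ r, δ e r * x r) ≤
      ∑ e, ((∫ ξ in (0 : ℝ)..(∑ r, δ e r * z r), c e ξ) -
        ∫ ξ in (0 : ℝ)..(∑ r, δ e r * x r), c e ξ) :=
    sum_le_sum fun e _ =>
      sub_mul_le_integral_sub_integral (hcont e) (hmono e) (hflow hx e) (hflow hz e)
  have hswap : ∑ r, routeCost δ c w x r * (z r - x r) =
      (∑ e, ((∑ r, δ e r * z r) - ∑ r, δ e r * x r) * c e (∑ r, δ e r * x r)) +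
        ((∑ r, w r * z r) - ∑ r, w r * x r) := by
    simp only [routeCost, add_mul, sum_add_distrib, sum_mul, ← sum_sub_distrib, ← mul_sub]
    rw [sum_comm]
    congr 1
    exact sum_congr rfl fun e _ => sum_congr rfl fun r _ => by ring
  rw [sum_sub_distrib] at hedge
  rw [hswap, beckmann, beckmann]
  linarith

/-- At an equilibrium, every feasible deviation has nonnegative cost. -/
lemma sum_mul_sub_nonneg_of_equilibrium {K : Type*} [Fintype K] [DecidableEq K]
    {cls : Route → K} {d : K → ℝ} (hd : ∀ k, 0 < d k) {C x z : Route → ℝ}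
    (hx : ∀ r, 0 ≤ x r) (hxd : ∀ k, ∑ r ∈ univ.filter (fun r => cls r = k), x r = d k)
    (hz : ∀ r, 0 ≤ z r) (hzd : ∀ k, ∑ r ∈ univ.filter (fun r => cls r = k), z r = d k)
    (heq : ∀ r r', cls r = cls r' → 0 < x r → C r ≤ C r') :
    0 ≤ ∑ r, C r * (z r - x r) := by
  have hused : ∀ k, ∃ r, cls r = k ∧ 0 < x r := by
    intro k
    have hpos : 0 < ∑ r ∈ univ.filter (fun r => cls r = k), x r := (hxd k).symm ▸ hd k
    obtain ⟨r, hr, hxr⟩ := exists_lt_of_sum_lt (f := fun _ => (0 : ℝ)) (by simpa using hpos)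
    exact ⟨r, (mem_filter.1 hr).2, hxr⟩
  choose s hs hxs using hused
  rw [← sum_fiberwise univ cls]
  refine sum_nonneg fun k _ => ?_
  calc (0 : ℝ) = ∑ r ∈ univ.filter (fun r => cls r = k), C (s k) * (z r - x r) := by
        rw [← mul_sum, sum_sub_distrib, hxd, hzd, sub_self, mul_zero]
    _ ≤ _ := sum_le_sum fun r hr => by
        have hrk : cls r = k := (mem_filter.1 hr).2
        have hle : C (s k) ≤ C r := heq _ _ ((hs k).trans hrk.symm) (hxs k)
        rcases (hx r).eq_or_lt with h0 | h0
        · rw [← h0, sub_zero]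
          exact mul_le_mul_of_nonneg_right hle (hz r)
        · rw [hle.antisymm (heq _ _ (hrk.trans (hs k).symm) h0)]

/-- The cost of a route is continuous on nonnegative route flows. -/
lemma tendsto_routeCost {δ : Edge → Route → ℝ} (hδ : ∀ e r, 0 ≤ δ e r)
    {c : Edge → ℝ → ℝ} (hcont : ∀ e, ContinuousOn (c e) (Set.Ici 0)) (w : Route → ℝ)
    {ι : Type*} {l : Filter ι} {u : ι → Route → ℝ} {x : Route → ℝ} (hx : ∀ r, 0 ≤ x r)
    (hu : ∀ᶠ t in l, ∀ r, 0 ≤ u t r) (hlim : Filter.Tendsto u l (nhds x)) (r : Route) :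
    Filter.Tendsto (fun t => routeCost δ c w (u t) r) l (nhds (routeCost δ c w x r)) := by
  refine (tendsto_finsetSum _ fun e _ => Filter.Tendsto.const_mul _ ?_).add_const _
  have hflow : ∀ {v : Route → ℝ}, (∀ r, 0 ≤ v r) → 0 ≤ ∑ r, δ e r * v r := fun hv =>
    sum_nonneg fun r _ => mul_nonneg (hδ e r) (hv r)
  refine (hcont e _ (hflow hx)).tendsto.comp (tendsto_nhdsWithin_iff.2 ⟨?_, ?_⟩)
  · exact tendsto_finsetSum _ fun ρ _ => (tendsto_pi_nhds.1 hlim ρ).const_mul _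
  · exact hu.mono fun t ht => hflow ht

end Beckmann

/-- Beckmann-type characterization of user equilibrium with
charging prices: a feasible route flow x* minimizes
B(x) = Σ_e ∫₀^{y_e(x)} c_e(ξ) dξ + Σ_r w_r x_r over the feasible polytope
iff it is a Wardrop user equilibrium. -/
theorem stmt8 {Edge Route : Type*} [Fintype Edge] [Fintype Route] {K : ℕ}
    (cls : Route → Fin K) (hcls : Function.Surjective cls)
    (d : Fin K → ℝ) (hd : ∀ k, 0 < d k)
    (δ : Edge → Route → ℝ) (hδ : ∀ e r, δ e r = 0 ∨ δ e r = 1)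
    (c : Edge → ℝ → ℝ)
    (hcont : ∀ e, ContinuousOn (c e) (Set.Ici 0))
    (hnonneg : ∀ e, ∀ t ∈ Set.Ici (0 : ℝ), 0 ≤ c e t)
    (hmono : ∀ e, MonotoneOn (c e) (Set.Ici 0))
    (w : Route → ℝ)
    (xStar : Route → ℝ)
    (hfeas : (∀ r, 0 ≤ xStar r) ∧
      ∀ k, ∑ r ∈ univ.filter (fun r => cls r = k), xStar r = d k) :
    (∀ x : Route → ℝ,
        ((∀ r, 0 ≤ x r) ∧ ∀ k, ∑ r ∈ univ.filter (fun r => cls r = k), x r = d k) →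
        (∑ e, ∫ ξ in (0 : ℝ)..(∑ r, δ e r * xStar r), c e ξ) + ∑ r, w r * xStar r ≤
          (∑ e, ∫ ξ in (0 : ℝ)..(∑ r, δ e r * x r), c e ξ) + ∑ r, w r * x r)
    ↔
    (∀ r r' : Route, cls r = cls r' → 0 < xStar r →
        (∑ e, δ e r * c e (∑ ρ, δ e ρ * xStar ρ)) + w r ≤
          (∑ e, δ e r' * c e (∑ ρ, δ e ρ * xStar ρ)) + w r') := by
  classical
  have hδ' : ∀ e r, 0 ≤ δ e r := fun e r => by rcases hδ e r with h | h <;> simp [h]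
  obtain ⟨hx, hxd⟩ := hfeas
  constructor
  · intro hmin r r' hrr' hr
    change routeCost δ c w xStar r ≤ routeCost δ c w xStar r'
    set u : ℝ → Route → ℝ := fun t => xStar + t • (Pi.single r' 1 - Pi.single r 1) with hu
    have hnear : ∀ᶠ t in nhdsWithin (0 : ℝ) (Set.Ioi 0), 0 < t ∧ t < xStar r :=
      Ioo_mem_nhdsGT hr
    have hunonneg : ∀ t, 0 < t ∧ t < xStar r → ∀ ρ, 0 ≤ u t ρ := by
      rintro t ⟨ht, htr⟩ ρ
      have hρ := hx ρ
      simp only [hu, Pi.add_apply, Pi.smul_apply, Pi.sub_apply, Pi.single_apply, smul_eq_mul]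
      by_cases h : ρ = r
      · subst h
        split_ifs <;> linarith
      · rw [if_neg h]
        split_ifs <;> linarith
    have hud : ∀ t k, ∑ ρ ∈ univ.filter (fun ρ => cls ρ = k), u t ρ = d k := by
      intro t k
      simp [hu, sum_add_distrib, ← mul_sum, hxd, Pi.single_apply, hrr']
    have hlim : Filter.Tendsto u (nhdsWithin (0 : ℝ) (Set.Ioi 0)) (nhds xStar) := by
      have hc : Continuous u := by fun_prop
      simpa [hu] using (hc.tendsto 0).mono_left nhdsWithin_le_nhds
    have hnn := hnear.mono hunonneg
    refine le_of_tendsto_of_tendsto (tendsto_routeCost hδ' hcont w hx hnn hlim r)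
      (tendsto_routeCost hδ' hcont w hx hnn hlim r') (hnear.mono fun t ht => ?_)
    have hsub := sum_routeCost_mul_sub_le hδ' hcont hmono w (hunonneg t ht) hx
    have hB : beckmann δ c w xStar ≤ beckmann δ c w (u t) := hmin _ ⟨hunonneg t ht, hud t⟩
    have hdir : ∑ ρ, routeCost δ c w (u t) ρ * (xStar ρ - u t ρ) =
        t * (routeCost δ c w (u t) r - routeCost δ c w (u t) r') := by
      have hterm : ∀ ρ, routeCost δ c w (u t) ρ * (xStar ρ - u t ρ) =
          t * (routeCost δ c w (u t) ρ * (Pi.single r 1 : Route → ℝ) ρ -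
            routeCost δ c w (u t) ρ * (Pi.single r' 1 : Route → ℝ) ρ) := fun ρ => by
        have : u t ρ = xStar ρ +
            t * ((Pi.single r' 1 : Route → ℝ) ρ - (Pi.single r 1 : Route → ℝ) ρ) := rfl
        rw [show xStar ρ - u t ρ =
          t * ((Pi.single r 1 : Route → ℝ) ρ - (Pi.single r' 1 : Route → ℝ) ρ) by
            rw [this]; ring]
        ring
      rw [sum_congr rfl fun ρ _ => hterm ρ, ← mul_sum, sum_sub_distrib]
      simp [Pi.single_apply]
    rw [hdir] at hsub
    exact sub_nonpos.1 (nonpos_of_mul_nonpos_right (hsub.trans (sub_nonpos.2 hB)) ht.1)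
  · rintro heq x ⟨hz, hzd⟩
    have hdev := sum_mul_sub_nonneg_of_equilibrium (C := routeCost δ c w xStar) hd hx hxd hz hzd heq
    exact sub_nonneg.1 (hdev.trans (sum_routeCost_mul_sub_le hδ' hcont hmono w hx hz))
end

section
/- Fix reals a > b > 0, q > 0, ℓ₁ ≥ 0, γ₁, γ₂ > 0, g₁^max, g₂^max > 0, f^max > 0. Consider the 2-bus GCE program: minimize (a/(2q²))s₁² + (b/q)s₂ + γ₁g₁² + γ₂g₂² over reals s₁, s₂, g₁, g₂, p₁ subject to p₁ = g₁ − ℓ₁ − s₁, −p₁ = g₂ − s₂, |p₁| ≤ f^max, s₁ + s₂ = q, s₁ ≥ 0, s₂ ≥ 0, 0 ≤ g₁ ≤ g₁^max, 0 ≤ g₂ ≤ g₂^max. Assume g₂^max < γ₁(ℓ₁ + q)/(γ₁ + γ₂), g₁^max ≥ ℓ₁ + q, and f^max ≥ |(a − b)q/a − g₂^max| (uncongested regime). Then the unique minimizer satisfies s₁ = bq/a, s₂ = (a − b)q/a, g₂ = g₂^max, g₁ = ℓ₁ + q − g₂^max, and p₁ = (a − b)q/a − g₂^max. -/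
/-- Feasible set of the 2-bus programs: a tuple (s₁, s₂, g₁, g₂, p₁) with
p₁ = g₁ − ℓ₁ − s₁, −p₁ = g₂ − s₂, |p₁| ≤ f^max, s₁ + s₂ = q, s₁, s₂ ≥ 0,
0 ≤ gᵢ ≤ gᵢ^max. -/
def TwoBusFeas (q ℓ₁ g1max g2max fmax : ℝ) : ℝ × ℝ × ℝ × ℝ × ℝ → Prop
  | (s₁, s₂, g₁, g₂, p₁) =>
    p₁ = g₁ - ℓ₁ - s₁ ∧ -p₁ = g₂ - s₂ ∧ |p₁| ≤ fmax ∧ s₁ + s₂ = q ∧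
      0 ≤ s₁ ∧ 0 ≤ s₂ ∧ 0 ≤ g₁ ∧ g₁ ≤ g1max ∧ 0 ≤ g₂ ∧ g₂ ≤ g2max

/-- Objective of the 2-bus GCE program:
(a/(2q²))s₁² + (b/q)s₂ + γ₁g₁² + γ₂g₂². -/
noncomputable def TwoBusObjGCE (a b q γ₁ γ₂ : ℝ) : ℝ × ℝ × ℝ × ℝ × ℝ → ℝ
  | (s₁, s₂, g₁, g₂, _) =>
    a / (2 * q ^ 2) * s₁ ^ 2 + b / q * s₂ + γ₁ * g₁ ^ 2 + γ₂ * g₂ ^ 2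

/-- On the feasible set, the gap between the objective and its value at the uncongested
point is the sum of a quadratic in `s₁ - b q / a` and a quadratic in `g2max - g₂`. -/
theorem twoBusObjGCE_sub_eq {a b q ℓ₁ γ₁ γ₂ g1max g2max fmax s₁ s₂ g₁ g₂ p₁ : ℝ}
    (ha : a ≠ 0) (hq : q ≠ 0)
    (h : TwoBusFeas q ℓ₁ g1max g2max fmax (s₁, s₂, g₁, g₂, p₁)) :
    TwoBusObjGCE a b q γ₁ γ₂ (s₁, s₂, g₁, g₂, p₁) -
      TwoBusObjGCE a b q γ₁ γ₂
        (b * q / a, (a - b) * q / a, ℓ₁ + q - g2max, g2max, (a - b) * q / a - g2max) =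
      a / (2 * q ^ 2) * (s₁ - b * q / a) ^ 2 +
        2 * (γ₁ * (ℓ₁ + q) - g2max * (γ₁ + γ₂)) * (g2max - g₂) +
        (γ₁ + γ₂) * (g2max - g₂) ^ 2 := by
  obtain ⟨hp, hp', -, hs, -⟩ := h
  obtain rfl : s₂ = q - s₁ := by linarith
  obtain rfl : g₁ = ℓ₁ + q - g₂ := by linarith
  simp only [TwoBusObjGCE]
  field_simp
  ring

/-- In the uncongested regime, the unique minimizer of the 2-bus
GCE program satisfies s₁ = bq/a, s₂ = (a−b)q/a, g₂ = g₂^max,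
g₁ = ℓ₁ + q − g₂^max, p₁ = (a−b)q/a − g₂^max. -/
theorem stmt9 (a b q ℓ₁ γ₁ γ₂ g1max g2max fmax : ℝ)
    (hab : b < a) (hb : 0 < b) (hq : 0 < q) (hℓ : 0 ≤ ℓ₁)
    (hγ₁ : 0 < γ₁) (hγ₂ : 0 < γ₂) (hg1 : 0 < g1max) (hg2 : 0 < g2max)
    (hf : 0 < fmax)
    (hreg1 : g2max < γ₁ * (ℓ₁ + q) / (γ₁ + γ₂))
    (hreg2 : ℓ₁ + q ≤ g1max)
    (hreg3 : |(a - b) * q / a - g2max| ≤ fmax) :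
    TwoBusFeas q ℓ₁ g1max g2max fmax
      (b * q / a, (a - b) * q / a, ℓ₁ + q - g2max, g2max, (a - b) * q / a - g2max) ∧
    (∀ Q, TwoBusFeas q ℓ₁ g1max g2max fmax Q →
      TwoBusObjGCE a b q γ₁ γ₂
          (b * q / a, (a - b) * q / a, ℓ₁ + q - g2max, g2max, (a - b) * q / a - g2max) ≤
        TwoBusObjGCE a b q γ₁ γ₂ Q) ∧
    (∀ Q, TwoBusFeas q ℓ₁ g1max g2max fmax Q →
      (∀ R, TwoBusFeas q ℓ₁ g1max g2max fmax R →
        TwoBusObjGCE a b q γ₁ γ₂ Q ≤ TwoBusObjGCE a b q γ₁ γ₂ R) →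
      Q = (b * q / a, (a - b) * q / a, ℓ₁ + q - g2max, g2max,
            (a - b) * q / a - g2max)) := by
  have ha : 0 < a := hb.trans hab
  have hγ : 0 < γ₁ + γ₂ := add_pos hγ₁ hγ₂
  have hslack : 0 < γ₁ * (ℓ₁ + q) - g2max * (γ₁ + γ₂) :=
    sub_pos.2 ((lt_div_iff₀ hγ).1 hreg1)
  have hsum : b * q / a + (a - b) * q / a = q := by
    field_simp
    ring
  have hfeas : TwoBusFeas q ℓ₁ g1max g2max fmax
      (b * q / a, (a - b) * q / a, ℓ₁ + q - g2max, g2max, (a - b) * q / a - g2max) := by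
    have hg : 0 ≤ ℓ₁ + q - g2max := by
      by_contra! hlt
      nlinarith [mul_pos hγ₂ hg2]
    have hab' : 0 < a - b := sub_pos.2 hab
    exact ⟨by linarith, by ring, hreg3, hsum, by positivity, by positivity, hg,
      by linarith, hg2.le, le_rfl⟩
  refine ⟨hfeas, ?_, ?_⟩
  · rintro ⟨s₁, s₂, g₁, g₂, p₁⟩ h
    have hgap := twoBusObjGCE_sub_eq (b := b) (γ₁ := γ₁) (γ₂ := γ₂) ha.ne' hq.ne' h
    obtain ⟨-, -, -, -, -, -, -, -, -, hg₂⟩ := h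
    have hd : 0 ≤ g2max - g₂ := sub_nonneg.2 hg₂
    rw [← sub_nonneg, hgap]
    positivity
  · rintro ⟨s₁, s₂, g₁, g₂, p₁⟩ h hmin
    have hgap := twoBusObjGCE_sub_eq (b := b) (γ₁ := γ₁) (γ₂ := γ₂) ha.ne' hq.ne' h
    have hle := hmin _ hfeas
    obtain ⟨hp, hp', -, hs, -, -, -, -, -, hg₂⟩ := h
    have hd : 0 ≤ g2max - g₂ := sub_nonneg.2 hg₂
    have hquad_s : 0 ≤ a / (2 * q ^ 2) * (s₁ - b * q / a) ^ 2 := by positivity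
    have hlin_g : 0 ≤ 2 * (γ₁ * (ℓ₁ + q) - g2max * (γ₁ + γ₂)) * (g2max - g₂) := by
      positivity
    have hquad_g : 0 ≤ (γ₁ + γ₂) * (g2max - g₂) ^ 2 := by positivity
    have hs_zero : a / (2 * q ^ 2) * (s₁ - b * q / a) ^ 2 = 0 := by linarith
    have hg_zero : (γ₁ + γ₂) * (g2max - g₂) ^ 2 = 0 := by linarith
    have hcoef : a / (2 * q ^ 2) ≠ 0 := by positivity
    have hs₁ : s₁ - b * q / a = 0 :=
      pow_eq_zero_iff two_ne_zero |>.1 ((mul_eq_zero.1 hs_zero).resolve_left hcoef)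
    have hg₂' : g2max - g₂ = 0 :=
      pow_eq_zero_iff two_ne_zero |>.1 ((mul_eq_zero.1 hg_zero).resolve_left hγ.ne')
    simp only [Prod.mk.injEq]
    refine ⟨?_, ?_, ?_, ?_, ?_⟩ <;> linarith
end

section
/- Fix reals a > b > 0, q > 0, ℓ₁ ≥ 0, γ₁, γ₂ > 0, g₁^max, g₂^max > 0, f^max > 0. Consider the 2-bus SWM program: minimize (a/q²)s₁² + (b/q)s₂ + γ₁g₁² + γ₂g₂² over reals s₁, s₂, g₁, g₂, p₁ subject to p₁ = g₁ − ℓ₁ − s₁, −p₁ = g₂ − s₂, |p₁| ≤ f^max, s₁ + s₂ = q, s₁ ≥ 0, s₂ ≥ 0, 0 ≤ g₁ ≤ g₁^max, 0 ≤ g₂ ≤ g₂^max. Assume g₂^max < γ₁(ℓ₁ + q)/(γ₁ + γ₂), g₁^max ≥ ℓ₁ + q, and f^max ≥ |(2a − b)q/(2a) − g₂^max| (uncongested regime). Then the unique minimizer satisfies s₁ = bq/(2a), s₂ = (2a − b)q/(2a), g₂ = g₂^max, and g₁ = ℓ₁ + q − g₂^max. In particular, the optimal s₁ of the SWM program equals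 exactly half the value bq/a attained by the corresponding GCE program, so the two programs have different minimizers. -/
/-- Objective of the 2-bus SWM program: (a/q²)s₁² + (b/q)s₂ + γ₁g₁² + γ₂g₂². -/
noncomputable def TwoBusObjSWM (a b q γ₁ γ₂ : ℝ) : ℝ × ℝ × ℝ × ℝ × ℝ → ℝ
  | (s₁, s₂, g₁, g₂, _) =>
    a / q ^ 2 * s₁ ^ 2 + b / q * s₂ + γ₁ * g₁ ^ 2 + γ₂ * g₂ ^ 2

/-- A point is a minimizer of an objective over a feasibility predicate. -/
def IsMinOf {α : Type*} (Feas : α → Prop) (f : α → ℝ) (P : α) : Prop :=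
  Feas P ∧ ∀ Q, Feas Q → f P ≤ f Q

/-- The uncongested optimum of the 2-bus SWM program. -/
noncomputable def twoBusOptSWM (a b q ℓ₁ g2max : ℝ) : ℝ × ℝ × ℝ × ℝ × ℝ :=
  (b * q / (2 * a), (2 * a - b) * q / (2 * a), ℓ₁ + q - g2max, g2max,
    (2 * a - b) * q / (2 * a) - g2max)

theorem twoBusFeas_optSWM {a b q ℓ₁ g1max g2max fmax : ℝ}
    (hab : b < a) (hb : 0 < b) (hq : 0 < q) (hg2 : 0 ≤ g2max) (hle : g2max ≤ ℓ₁ + q)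
    (hreg2 : ℓ₁ + q ≤ g1max) (hreg3 : |(2 * a - b) * q / (2 * a) - g2max| ≤ fmax) :
    TwoBusFeas q ℓ₁ g1max g2max fmax (twoBusOptSWM a b q ℓ₁ g2max) := by
  have ha : 0 < a := hb.trans hab
  have hsum : b * q / (2 * a) + (2 * a - b) * q / (2 * a) = q := by
    field_simp
    ring
  have hs₂ : 0 ≤ (2 * a - b) * q / (2 * a) :=
    div_nonneg (mul_nonneg (by linarith) hq.le) (by linarith)
  exact ⟨by linarith, by ring, hreg3, hsum, by positivity, hs₂, by linarith, by linarith,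
    hg2, le_rfl⟩

/-- The optimality gap of a feasible point is an explicit sum of terms that are nonnegative when
`(γ₁ + γ₂) * g2max ≤ γ₁ * (ℓ₁ + q)`. -/
theorem twoBusObjSWM_sub_opt {a b q ℓ₁ γ₁ γ₂ g1max g2max fmax s₁ s₂ g₁ g₂ p₁ : ℝ}
    (ha : a ≠ 0) (hq : q ≠ 0)
    (h : TwoBusFeas q ℓ₁ g1max g2max fmax (s₁, s₂, g₁, g₂, p₁)) :
    TwoBusObjSWM a b q γ₁ γ₂ (s₁, s₂, g₁, g₂, p₁) -
        TwoBusObjSWM a b q γ₁ γ₂ (twoBusOptSWM a b q ℓ₁ g2max) =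
      a / q ^ 2 * (s₁ - b * q / (2 * a)) ^ 2 + (γ₁ + γ₂) * (g2max - g₂) ^ 2 +
        2 * (g2max - g₂) * (γ₁ * (ℓ₁ + q) - (γ₁ + γ₂) * g2max) := by
  obtain ⟨hp, hp', -, hs, -⟩ := h
  obtain rfl : s₂ = q - s₁ := by linarith
  obtain rfl : g₁ = ℓ₁ + q - g₂ := by linarith
  simp only [TwoBusObjSWM, twoBusOptSWM]
  field_simp
  ring

theorem isMinOf_twoBusObjSWM_iff {a b q ℓ₁ γ₁ γ₂ g1max g2max fmax : ℝ}
    (hab : b < a) (hb : 0 < b) (hq : 0 < q) (hγ₁ : 0 < γ₁) (hγ₂ : 0 < γ₂) (hg2 : 0 ≤ g2max)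
    (hreg1 : (γ₁ + γ₂) * g2max ≤ γ₁ * (ℓ₁ + q)) (hreg2 : ℓ₁ + q ≤ g1max)
    (hreg3 : |(2 * a - b) * q / (2 * a) - g2max| ≤ fmax) (P : ℝ × ℝ × ℝ × ℝ × ℝ) :
    IsMinOf (TwoBusFeas q ℓ₁ g1max g2max fmax) (TwoBusObjSWM a b q γ₁ γ₂) P ↔
      P = twoBusOptSWM a b q ℓ₁ g2max := by
  have ha : 0 < a := hb.trans hab
  have hle : g2max ≤ ℓ₁ + q :=
    le_of_mul_le_mul_left (by nlinarith [mul_nonneg hγ₂.le hg2]) hγ₁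
  have hfeas : TwoBusFeas q ℓ₁ g1max g2max fmax (twoBusOptSWM a b q ℓ₁ g2max) :=
    twoBusFeas_optSWM hab hb hq hg2 hle hreg2 hreg3
  constructor
  · obtain ⟨s₁, s₂, g₁, g₂, p₁⟩ := P
    rintro ⟨hP, hmin⟩
    have hgap := twoBusObjSWM_sub_opt (b := b) (γ₁ := γ₁) (γ₂ := γ₂) ha.ne' hq.ne' hP
    have hopt := hmin _ hfeas
    obtain ⟨hp, hp', -, hs, -, -, -, -, -, hg₂⟩ := hP
    obtain ⟨-, -, -, hs', -⟩ := hfeas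
    have hlin : 0 ≤ 2 * (g2max - g₂) * (γ₁ * (ℓ₁ + q) - (γ₁ + γ₂) * g2max) :=
      mul_nonneg (by linarith) (by linarith)
    have hsq_s : 0 ≤ a / q ^ 2 * (s₁ - b * q / (2 * a)) ^ 2 := by positivity
    have hsq_g : 0 ≤ (γ₁ + γ₂) * (g2max - g₂) ^ 2 := by positivity
    have hs₁ : s₁ - b * q / (2 * a) = 0 := by
      have hzero : a / q ^ 2 * (s₁ - b * q / (2 * a)) ^ 2 = 0 := by linarith
      exact pow_eq_zero_iff two_ne_zero |>.1
        ((mul_eq_zero.1 hzero).resolve_left (by positivity))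
    have hg₂' : g2max - g₂ = 0 := by
      have hzero : (γ₁ + γ₂) * (g2max - g₂) ^ 2 = 0 := by linarith
      exact pow_eq_zero_iff two_ne_zero |>.1
        ((mul_eq_zero.1 hzero).resolve_left (by positivity))
    simp only [twoBusOptSWM, Prod.mk.injEq]
    refine ⟨?_, ?_, ?_, ?_, ?_⟩ <;> linarith
  · rintro rfl
    refine ⟨hfeas, ?_⟩
    rintro ⟨s₁, s₂, g₁, g₂, p₁⟩ hQ
    have hgap := twoBusObjSWM_sub_opt (b := b) (γ₁ := γ₁) (γ₂ := γ₂) ha.ne' hq.ne' hQ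
    obtain ⟨-, -, -, -, -, -, -, -, -, hg₂⟩ := hQ
    have hlin : 0 ≤ 2 * (g2max - g₂) * (γ₁ * (ℓ₁ + q) - (γ₁ + γ₂) * g2max) :=
      mul_nonneg (by linarith) (by linarith)
    have hsq_s : 0 ≤ a / q ^ 2 * (s₁ - b * q / (2 * a)) ^ 2 := by positivity
    have hsq_g : 0 ≤ (γ₁ + γ₂) * (g2max - g₂) ^ 2 := by positivity
    linarith

/-- In the uncongested regime, the unique minimizer of the 2-bus
SWM program satisfies s₁ = bq/(2a), s₂ = (2a−b)q/(2a), g₂ = g₂^max,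
g₁ = ℓ₁ + q − g₂^max. In particular the optimal s₁ equals half the value bq/a
attained by the GCE program, so the two programs have different minimizers. -/
theorem stmt10 (a b q ℓ₁ γ₁ γ₂ g1max g2max fmax : ℝ)
    (hab : b < a) (hb : 0 < b) (hq : 0 < q) (hℓ : 0 ≤ ℓ₁)
    (hγ₁ : 0 < γ₁) (hγ₂ : 0 < γ₂) (hg1 : 0 < g1max) (hg2 : 0 < g2max)
    (hf : 0 < fmax)
    (hreg1 : g2max < γ₁ * (ℓ₁ + q) / (γ₁ + γ₂))
    (hreg2 : ℓ₁ + q ≤ g1max)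
    (hreg3 : |(2 * a - b) * q / (2 * a) - g2max| ≤ fmax) :
    (∃ P, IsMinOf (TwoBusFeas q ℓ₁ g1max g2max fmax) (TwoBusObjSWM a b q γ₁ γ₂) P) ∧
    (∀ P Q, IsMinOf (TwoBusFeas q ℓ₁ g1max g2max fmax) (TwoBusObjSWM a b q γ₁ γ₂) P →
      IsMinOf (TwoBusFeas q ℓ₁ g1max g2max fmax) (TwoBusObjSWM a b q γ₁ γ₂) Q → P = Q) ∧
    (∀ P, IsMinOf (TwoBusFeas q ℓ₁ g1max g2max fmax) (TwoBusObjSWM a b q γ₁ γ₂) P →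
      P.1 = b * q / (2 * a) ∧ P.2.1 = (2 * a - b) * q / (2 * a) ∧
      P.2.2.2.1 = g2max ∧ P.2.2.1 = ℓ₁ + q - g2max ∧
      P.1 = (b * q / a) / 2) ∧
    (∀ P Q, IsMinOf (TwoBusFeas q ℓ₁ g1max g2max fmax) (TwoBusObjSWM a b q γ₁ γ₂) P →
      IsMinOf (TwoBusFeas q ℓ₁ g1max g2max fmax) (TwoBusObjGCE a b q γ₁ γ₂) Q →
      Q.1 = b * q / a → P ≠ Q) := by
  have ha : 0 < a := hb.trans hab
  have hreg1' : (γ₁ + γ₂) * g2max ≤ γ₁ * (ℓ₁ + q) := by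
    rw [lt_div_iff₀ (by positivity)] at hreg1
    linarith
  have hhalf : b * q / (2 * a) = b * q / a / 2 := by
    field_simp
  simp only [isMinOf_twoBusObjSWM_iff hab hb hq hγ₁ hγ₂ hg2.le hreg1' hreg2 hreg3]
  refine ⟨⟨_, rfl⟩, fun P Q hP hQ => hP.trans hQ.symm, ?_, ?_⟩
  · rintro P rfl
    exact ⟨rfl, rfl, rfl, rfl, hhalf⟩
  · rintro P Q rfl - hQ rfl
    have hpos : 0 < b * q / a := by positivity
    have heq : b * q / (2 * a) = b * q / a := hQ
    linarith
end

section
/- Fix reals a > b > 0, q > 0, ℓ₁ ≥ 0, γ₁, γ₂ > 0, g₁^max, g₂^max > 0, f^max > 0 with g₂^max ≥ (2a − b)q/(2a), g₂^max < γ₁(ℓ₁ + q)/(γ₁ + γ₂), g₁^max ≥ ℓ₁ + q, and suppose g₂^max − (2a − b)q/(2a) < f^max < g₂^max − (a − b)q/a. Assume additionally the generator-2 binding condition 2γ₂g₂^max ≤ 2γ₁(ℓ₁ + q − g₂^max) − (a/q²)(g₂^max − (a − b)q/a − f^max). Then: (i) the unique minimizer of the 2-bus GCE program satisfies s₁ =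 q − g₂^max + f^max, g₂ = g₂^max, g₁ = ℓ₁ + q − g₂^max, and p₁ = −f^max (the transmission line is congested); while (ii) the unique minimizer of the 2-bus SWM program satisfies s₁ = bq/(2a) with |p₁| < f^max (uncongested). In particular q − g₂^max + f^max < bq/a and the two programs have different minimizers. -/
theorem eq_zero_of_mul_sq_add_mul_sq_nonpos {k m u v : ℝ} (hk : 0 < k) (hm : 0 < m)
    (h : k * u ^ 2 + m * v ^ 2 ≤ 0) : u = 0 ∧ v = 0 := by
  have hu : 0 ≤ k * u ^ 2 := by positivity
  have hv : 0 ≤ m * v ^ 2 := by positivity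
  have hu0 : k * u ^ 2 = 0 := by linarith
  have hv0 : m * v ^ 2 = 0 := by linarith
  exact ⟨by simpa [hk.ne'] using hu0, by simpa [hm.ne'] using hv0⟩

/-- A feasible point that every feasible point at most as costly must equal is a minimizer. -/
theorem IsMinOf.of_forall_le_imp_eq {α : Type*} {Feas : α → Prop} {f : α → ℝ} {P : α}
    (hP : Feas P) (h : ∀ Q, Feas Q → f Q ≤ f P → Q = P) : IsMinOf Feas f P := by
  refine ⟨hP, fun Q hQ => le_of_not_gt fun hlt => ?_⟩
  rw [h Q hQ hlt.le] at hlt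
  exact lt_irrefl _ hlt

/-- Reduction of an objective comparison to a quadratic form: `A` is the curvature in `s₁`, `B` the
linear cost, `lam` the congestion multiplier, and `(s, x)` a point satisfying the first-order
conditions with generator 2 at its upper limit. -/
theorem eq_of_twoBus_first_order {A B γ₁ γ₂ L q s x s' x' lam : ℝ} (hA : 0 < A)
    (hγ₁ : 0 < γ₁) (hγ₂ : 0 < γ₂) (hs : 2 * A * s - B = -lam)
    (hx : 2 * γ₂ * x + lam ≤ 2 * γ₁ * (L - x)) (hxle : x' ≤ x)
    (hslack : 0 ≤ lam * (s + x - s' - x'))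
    (hle : A * s' ^ 2 + B * (q - s') + γ₁ * (L - x') ^ 2 + γ₂ * x' ^ 2 ≤
      A * s ^ 2 + B * (q - s) + γ₁ * (L - x) ^ 2 + γ₂ * x ^ 2) : s' = s ∧ x' = x := by
  have hgrad : 0 ≤ (2 * γ₁ * (L - x) - 2 * γ₂ * x - lam) * (x - x') :=
    mul_nonneg (by linarith) (by linarith)
  have hB : B = 2 * A * s + lam := by linarith
  subst hB
  obtain ⟨h₁, h₂⟩ := eq_zero_of_mul_sq_add_mul_sq_nonpos (u := s' - s) (v := x' - x) hA
    (add_pos hγ₁ hγ₂) (by nlinarith)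
  exact ⟨by linarith, by linarith⟩

/-- In the intermediate transmission-capacity regime (with the
generator-2 binding condition), the GCE program is congested with unique
minimizer s₁ = q − g₂^max + f^max, g₂ = g₂^max, g₁ = ℓ₁ + q − g₂^max,
p₁ = −f^max, while the SWM program is uncongested with unique minimizer
satisfying s₁ = bq/(2a) and |p₁| < f^max; moreover
q − g₂^max + f^max < bq/a and the two minimizers differ. -/
theorem stmt11 (a b q ℓ₁ γ₁ γ₂ g1max g2max fmax : ℝ)
    (hab : b < a) (hb : 0 < b) (hq : 0 < q) (hℓ : 0 ≤ ℓ₁)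
    (hγ₁ : 0 < γ₁) (hγ₂ : 0 < γ₂) (hg1 : 0 < g1max) (hg2 : 0 < g2max)
    (hf : 0 < fmax)
    (hreg0 : (2 * a - b) * q / (2 * a) ≤ g2max)
    (hreg1 : g2max < γ₁ * (ℓ₁ + q) / (γ₁ + γ₂))
    (hreg2 : ℓ₁ + q ≤ g1max)
    (hflow : g2max - (2 * a - b) * q / (2 * a) < fmax ∧
      fmax < g2max - (a - b) * q / a)
    (hbind : 2 * γ₂ * g2max ≤
      2 * γ₁ * (ℓ₁ + q - g2max) - a / q ^ 2 * (g2max - (a - b) * q / a - fmax)) :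
    (IsMinOf (TwoBusFeas q ℓ₁ g1max g2max fmax) (TwoBusObjGCE a b q γ₁ γ₂)
        (q - g2max + fmax, g2max - fmax, ℓ₁ + q - g2max, g2max, -fmax) ∧
      ∀ Q, IsMinOf (TwoBusFeas q ℓ₁ g1max g2max fmax) (TwoBusObjGCE a b q γ₁ γ₂) Q →
        Q = (q - g2max + fmax, g2max - fmax, ℓ₁ + q - g2max, g2max, -fmax)) ∧
    ((∃ P, IsMinOf (TwoBusFeas q ℓ₁ g1max g2max fmax) (TwoBusObjSWM a b q γ₁ γ₂) P) ∧
      (∀ P Q, IsMinOf (TwoBusFeas q ℓ₁ g1max g2max fmax) (TwoBusObjSWM a b q γ₁ γ₂) P →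
        IsMinOf (TwoBusFeas q ℓ₁ g1max g2max fmax) (TwoBusObjSWM a b q γ₁ γ₂) Q → P = Q) ∧
      (∀ P, IsMinOf (TwoBusFeas q ℓ₁ g1max g2max fmax) (TwoBusObjSWM a b q γ₁ γ₂) P →
        P.1 = b * q / (2 * a) ∧ |P.2.2.2.2| < fmax)) ∧
    (q - g2max + fmax < b * q / a) ∧
    (∀ P Q, IsMinOf (TwoBusFeas q ℓ₁ g1max g2max fmax) (TwoBusObjGCE a b q γ₁ γ₂) P →
      IsMinOf (TwoBusFeas q ℓ₁ g1max g2max fmax) (TwoBusObjSWM a b q γ₁ γ₂) Q →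
      P ≠ Q) := by
  have ha : 0 < a := hb.trans hab
  have hA : 0 < a / q ^ 2 := by positivity
  have hA2 : 0 < a / (2 * q ^ 2) := by positivity
  have hAA : a / (2 * q ^ 2) = a / q ^ 2 / 2 := by field_simp
  have hpos : 0 < b * q / a := by positivity
  have hlt : b * q / a < q := by rw [div_lt_iff₀ ha]; nlinarith
  have hhalf : b * q / (2 * a) = b * q / a / 2 := by field_simp
  have hdiff : (a - b) * q / a = q - b * q / a := by field_simp
  have hdiff2 : (2 * a - b) * q / (2 * a) = q - b * q / a / 2 := by field_simp
  have hB : b / q = a / q ^ 2 * (b * q / a) := by field_simp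
  rw [hdiff2] at hreg0
  rw [hdiff, hdiff2] at hflow
  rw [hdiff] at hbind
  obtain ⟨hf₁, hf₂⟩ := hflow
  rw [lt_div_iff₀ (by positivity)] at hreg1
  have hGL : g2max < ℓ₁ + q := by
    by_contra! h
    nlinarith [mul_pos hγ₂ hg2]
  rw [hhalf]
  generalize b * q / a = t at *
  have hfeasGCE : TwoBusFeas q ℓ₁ g1max g2max fmax
      (q - g2max + fmax, g2max - fmax, ℓ₁ + q - g2max, g2max, -fmax) := by
    refine ⟨by ring, by ring, by rw [abs_neg, abs_of_pos hf], by ring, ?_, ?_, ?_, ?_, ?_, ?_⟩ <;>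
      linarith
  have hfeasSWM : TwoBusFeas q ℓ₁ g1max g2max fmax
      (t / 2, q - t / 2, ℓ₁ + q - g2max, g2max, q - g2max - t / 2) := by
    refine ⟨by ring, by ring, abs_le.2 ⟨?_, ?_⟩, by ring, ?_, ?_, ?_, ?_, ?_, ?_⟩ <;> linarith
  have hGCE : ∀ Q, TwoBusFeas q ℓ₁ g1max g2max fmax Q → TwoBusObjGCE a b q γ₁ γ₂ Q ≤
      TwoBusObjGCE a b q γ₁ γ₂
        (q - g2max + fmax, g2max - fmax, ℓ₁ + q - g2max, g2max, -fmax) →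
      Q = (q - g2max + fmax, g2max - fmax, ℓ₁ + q - g2max, g2max, -fmax) := by
    rintro ⟨s₁, s₂, g₁, g₂, p₁⟩ ⟨hp, hp', habs, hs, -, -, -, -, -, hg⟩ hle
    obtain rfl : s₂ = q - s₁ := by linarith
    obtain rfl : g₁ = ℓ₁ + q - g₂ := by linarith
    simp only [TwoBusObjGCE] at hle
    obtain ⟨rfl, rfl⟩ := eq_of_twoBus_first_order (q := q) (s := q - g2max + fmax)
      (lam := a / q ^ 2 * (g2max - (q - t) - fmax)) hA2 hγ₁ hγ₂
      (by rw [hAA, hB]; ring) (by linarith) hg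
      (mul_nonneg (mul_nonneg hA.le (by linarith)) (by linarith [(abs_le.1 habs).1]))
      (hle.trans_eq (by ring))
    simp only [Prod.mk.injEq, true_and]
    exact ⟨by ring, by linarith⟩
  have hSWM : ∀ Q, TwoBusFeas q ℓ₁ g1max g2max fmax Q → TwoBusObjSWM a b q γ₁ γ₂ Q ≤
      TwoBusObjSWM a b q γ₁ γ₂
        (t / 2, q - t / 2, ℓ₁ + q - g2max, g2max, q - g2max - t / 2) →
      Q = (t / 2, q - t / 2, ℓ₁ + q - g2max, g2max, q - g2max - t / 2) := by
    rintro ⟨s₁, s₂, g₁, g₂, p₁⟩ ⟨hp, hp', habs, hs, -, -, -, -, -, hg⟩ hle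
    obtain rfl : s₂ = q - s₁ := by linarith
    obtain rfl : g₁ = ℓ₁ + q - g₂ := by linarith
    simp only [TwoBusObjSWM] at hle
    obtain ⟨rfl, rfl⟩ := eq_of_twoBus_first_order (q := q) (s := t / 2) (lam := 0) hA hγ₁ hγ₂
      (by rw [hB]; ring) (by linarith) hg (by simp) hle
    simp only [Prod.mk.injEq, true_and]
    linarith
  have hminGCE := IsMinOf.of_forall_le_imp_eq hfeasGCE hGCE
  have hminSWM := IsMinOf.of_forall_le_imp_eq hfeasSWM hSWM
  have huniqGCE := fun Q (hQ : IsMinOf _ (TwoBusObjGCE a b q γ₁ γ₂) Q) =>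
    hGCE Q hQ.1 (hQ.2 _ hfeasGCE)
  have huniqSWM := fun Q (hQ : IsMinOf _ (TwoBusObjSWM a b q γ₁ γ₂) Q) =>
    hSWM Q hQ.1 (hQ.2 _ hfeasSWM)
  refine ⟨⟨hminGCE, huniqGCE⟩, ⟨⟨_, hminSWM⟩, ?_, ?_⟩, by linarith, ?_⟩
  · intro P Q hP hQ
    rw [huniqSWM P hP, huniqSWM Q hQ]
  · intro P hP
    rw [huniqSWM P hP]
    exact ⟨rfl, abs_lt.2 ⟨by linarith, by linarith⟩⟩
  · intro P Q hP hQ hPQ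
    rw [huniqGCE P hP, huniqSWM Q hQ] at hPQ
    have hs := congrArg Prod.fst hPQ
    dsimp only at hs
    linarith
end

section
/- Fix reals a > b > 0, q > 0, ℓ₁ ≥ 0, γ₁, γ₂ > 0, g₁^max, g₂^max > 0, f^max > 0 with g₂^max < γ₁(ℓ₁ + q)/(γ₁ + γ₂), g₁^max ≥ ℓ₁ + q, g₂^max − q ≤ f^max ≤ g₂^max − (2a − b)q/(2a). Assume additionally the generator-2 binding conditions 2γ₂g₂^max ≤ 2γ₁(ℓ₁ + q − g₂^max) − (a/q²)(g₂^max − (a − b)q/a − f^max) and 2γ₂g₂^max ≤ 2γ₁(ℓ₁ + q − g₂^max) − (2a/q²)(g₂^max − (2a − b)q/(2a) − f^max). Then the unique minimizers of the 2-bus GCE program and of the 2-bus SWM program coincide: both satisfy s₁ = q − g₂^max + f^max, s₂ = g₂^max − f^max, g₂ = g₂^max, g₁ = ℓ₁ + q − g₂^max, and p₁ = −f^max. In particular, in this congested regime the GCE supports social welfare. -/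
/-- Quadratic growth of a separable two-bus objective, with quadratic coefficient `c` in `s₁`
and linear coefficient `d` in `s₂`, around the congested point. The flow constraint has the nonnegative
multiplier `d - 2 * c * (q - g2max + fmax)`. -/
lemma twoBus_quadratic_growth {c d q ℓ₁ γ₁ γ₂ g1max g2max fmax s₁ s₂ g₁ g₂ p₁ : ℝ}
    (hmult : 2 * c * (q - g2max + fmax) ≤ d)
    (hbind : 2 * γ₂ * g2max ≤
      2 * γ₁ * (ℓ₁ + q - g2max) - (d - 2 * c * (q - g2max + fmax)))
    (hfeas : TwoBusFeas q ℓ₁ g1max g2max fmax (s₁, s₂, g₁, g₂, p₁)) :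
    c * (q - g2max + fmax) ^ 2 + d * (g2max - fmax) + γ₁ * (ℓ₁ + q - g2max) ^ 2 +
        γ₂ * g2max ^ 2 + (c * (s₁ - (q - g2max + fmax)) ^ 2 + (γ₁ + γ₂) * (g₂ - g2max) ^ 2) ≤
      c * s₁ ^ 2 + d * s₂ + γ₁ * g₁ ^ 2 + γ₂ * g₂ ^ 2 := by
  obtain ⟨hp, hp', hflow, hs, -, -, -, -, -, hg₂⟩ := hfeas
  have hp_lower := (abs_le.mp hflow).1
  obtain rfl : s₂ = q - s₁ := by linarith
  obtain rfl : g₁ = ℓ₁ + q - g₂ := by linarith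
  have hcap : 0 ≤ q + fmax - s₁ - g₂ := by linarith
  linear_combination mul_nonneg (sub_nonneg.mpr hmult) hcap +
    mul_nonneg (sub_nonneg.mpr hbind) (sub_nonneg.mpr hg₂)

/-- If an objective has the separable two-bus form and the optimality conditions hold at the
congested point, then that point is the unique minimizer. -/
lemma twoBus_isMinOf_unique {c d q ℓ₁ γ₁ γ₂ g1max g2max fmax : ℝ}
    {f : ℝ × ℝ × ℝ × ℝ × ℝ → ℝ}
    (hobj : ∀ s₁ s₂ g₁ g₂ p₁,
      f (s₁, s₂, g₁, g₂, p₁) = c * s₁ ^ 2 + d * s₂ + γ₁ * g₁ ^ 2 + γ₂ * g₂ ^ 2)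
    (hc : 0 < c) (hγ : 0 < γ₁ + γ₂)
    (hmult : 2 * c * (q - g2max + fmax) ≤ d)
    (hbind : 2 * γ₂ * g2max ≤
      2 * γ₁ * (ℓ₁ + q - g2max) - (d - 2 * c * (q - g2max + fmax)))
    (hfeas : TwoBusFeas q ℓ₁ g1max g2max fmax
      (q - g2max + fmax, g2max - fmax, ℓ₁ + q - g2max, g2max, -fmax)) :
    IsMinOf (TwoBusFeas q ℓ₁ g1max g2max fmax) f
        (q - g2max + fmax, g2max - fmax, ℓ₁ + q - g2max, g2max, -fmax) ∧
      ∀ Q, IsMinOf (TwoBusFeas q ℓ₁ g1max g2max fmax) f Q →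
        Q = (q - g2max + fmax, g2max - fmax, ℓ₁ + q - g2max, g2max, -fmax) := by
  refine ⟨⟨hfeas, ?_⟩, ?_⟩
  · rintro ⟨s₁, s₂, g₁, g₂, p₁⟩ hQ
    rw [hobj, hobj]
    refine le_trans (le_add_of_nonneg_right ?_) (twoBus_quadratic_growth hmult hbind hQ)
    positivity
  · rintro ⟨s₁, s₂, g₁, g₂, p₁⟩ ⟨hQ, hmin⟩
    have hle := hmin _ hfeas
    rw [hobj, hobj] at hle
    have hgrowth := twoBus_quadratic_growth hmult hbind hQ
    have hs_nonneg : 0 ≤ c * (s₁ - (q - g2max + fmax)) ^ 2 := by positivity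
    have hg_nonneg : 0 ≤ (γ₁ + γ₂) * (g₂ - g2max) ^ 2 := by positivity
    have hs_zero : c * (s₁ - (q - g2max + fmax)) ^ 2 = 0 := by linarith
    have hg_zero : (γ₁ + γ₂) * (g₂ - g2max) ^ 2 = 0 := by linarith
    have hs₁ : s₁ - (q - g2max + fmax) = 0 := by simpa [hc.ne'] using hs_zero
    have hg₂ : g₂ - g2max = 0 := by simpa [hγ.ne'] using hg_zero
    obtain ⟨hp, hp', -, hs, -⟩ := hQ
    simp only [Prod.mk.injEq]
    refine ⟨?_, ?_, ?_, ?_, ?_⟩ <;> linarith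

/-- In the congested regime (with generator-2 binding conditions),
the unique minimizers of the 2-bus GCE and SWM programs coincide: both equal
(s₁, s₂, g₁, g₂, p₁) = (q − g₂^max + f^max, g₂^max − f^max, ℓ₁ + q − g₂^max,
g₂^max, −f^max); the GCE supports social welfare. -/
theorem stmt12 (a b q ℓ₁ γ₁ γ₂ g1max g2max fmax : ℝ)
    (hab : b < a) (hb : 0 < b) (hq : 0 < q) (hℓ : 0 ≤ ℓ₁)
    (hγ₁ : 0 < γ₁) (hγ₂ : 0 < γ₂) (hg1 : 0 < g1max) (hg2 : 0 < g2max)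
    (hf : 0 < fmax)
    (hreg1 : g2max < γ₁ * (ℓ₁ + q) / (γ₁ + γ₂))
    (hreg2 : ℓ₁ + q ≤ g1max)
    (hflow : g2max - q ≤ fmax ∧ fmax ≤ g2max - (2 * a - b) * q / (2 * a))
    (hbind1 : 2 * γ₂ * g2max ≤
      2 * γ₁ * (ℓ₁ + q - g2max) - a / q ^ 2 * (g2max - (a - b) * q / a - fmax))
    (hbind2 : 2 * γ₂ * g2max ≤
      2 * γ₁ * (ℓ₁ + q - g2max) -
        2 * a / q ^ 2 * (g2max - (2 * a - b) * q / (2 * a) - fmax)) :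
    (IsMinOf (TwoBusFeas q ℓ₁ g1max g2max fmax) (TwoBusObjGCE a b q γ₁ γ₂)
        (q - g2max + fmax, g2max - fmax, ℓ₁ + q - g2max, g2max, -fmax) ∧
      ∀ Q, IsMinOf (TwoBusFeas q ℓ₁ g1max g2max fmax) (TwoBusObjGCE a b q γ₁ γ₂) Q →
        Q = (q - g2max + fmax, g2max - fmax, ℓ₁ + q - g2max, g2max, -fmax)) ∧
    (IsMinOf (TwoBusFeas q ℓ₁ g1max g2max fmax) (TwoBusObjSWM a b q γ₁ γ₂)
        (q - g2max + fmax, g2max - fmax, ℓ₁ + q - g2max, g2max, -fmax) ∧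
      ∀ Q, IsMinOf (TwoBusFeas q ℓ₁ g1max g2max fmax) (TwoBusObjSWM a b q γ₁ γ₂) Q →
        Q = (q - g2max + fmax, g2max - fmax, ℓ₁ + q - g2max, g2max, -fmax)) := by
  have ha : 0 < a := hb.trans hab
  obtain ⟨hflow_lower, hflow_upper⟩ := hflow
  have hshare : (2 * a - b) * q / (2 * a) = q - b * q / (2 * a) := by field_simp
  have hshare_nonneg : 0 ≤ (2 * a - b) * q / (2 * a) :=
    div_nonneg (mul_nonneg (by linarith) hq.le) (by linarith)
  have hg2max : g2max ≤ ℓ₁ + q := by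
    rw [lt_div_iff₀ (by positivity)] at hreg1
    nlinarith [mul_pos hg2 hγ₂]
  have hfeas : TwoBusFeas q ℓ₁ g1max g2max fmax
      (q - g2max + fmax, g2max - fmax, ℓ₁ + q - g2max, g2max, -fmax) := by
    refine ⟨by ring, by ring, by rw [abs_neg, abs_of_pos hf], by ring, ?_, ?_, ?_, ?_, hg2.le,
      le_rfl⟩ <;> linarith
  have hmult : 2 * (a / q ^ 2) * (q - g2max + fmax) ≤ b / q :=
    calc 2 * (a / q ^ 2) * (q - g2max + fmax)
        ≤ 2 * (a / q ^ 2) * (b * q / (2 * a)) := by gcongr; linarith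
      _ = b / q := by field_simp
  have hs₁ : 0 ≤ a / q ^ 2 * (q - g2max + fmax) := mul_nonneg (by positivity) (by linarith)
  have hhalf : 2 * (a / (2 * q ^ 2)) = a / q ^ 2 := by field_simp
  constructor
  · refine twoBus_isMinOf_unique (c := a / (2 * q ^ 2)) (d := b / q) (fun _ _ _ _ _ => rfl)
      (by positivity) (by positivity) ?_ ?_ hfeas
    · rw [hhalf]
      linarith
    · convert hbind1 using 2
      field_simp
      ring
  · refine twoBus_isMinOf_unique (c := a / q ^ 2) (d := b / q) (fun _ _ _ _ _ => rfl)
      (by positivity) (by positivity) hmult ?_ hfeas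
    convert hbind2 using 2
    field_simp
    ring
end

section
/- Let X ⊆ ℝ^n be a nonempty, compact, convex set and let F : ℝ^n → ℝ^n be continuous on X and strictly monotone on X, i.e. ⟨F(x) − F(y), x − y⟩ > 0 for all x, y ∈ X with x ≠ y. Then there exists exactly one x* ∈ X satisfying the variational inequality ⟨F(x*), x − x*⟩ ≥ 0 for all x ∈ X. -/
open scoped RealInnerProductSpace

section MintyLemma

variable {E : Type*} [NormedAddCommGroup E] [InnerProductSpace ℝ E] {X : Set E} {F : E → E}

/-- A weighted double sum of `⟪F yᵢ, yᵢ - yⱼ⟫` with nonnegative weights is nonnegative for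
monotone `F`. -/
lemma sum_sum_inner_nonneg_of_monotone {ι : Type*} [Fintype ι]
    (hF : ∀ x ∈ X, ∀ y ∈ X, 0 ≤ ⟪F x - F y, x - y⟫)
    {y : ι → E} (hy : ∀ i, y i ∈ X) {c : ι → ℝ} (hc : ∀ i, 0 ≤ c i) :
    0 ≤ ∑ i, ∑ j, c i * c j * ⟪F (y i), y i - y j⟫ := by
  have hsymm : ∑ i, ∑ j, c i * c j * ⟪F (y i), y i - y j⟫
      = ∑ i, ∑ j, c i * c j * ⟪F (y j), y j - y i⟫ := by
    rw [Finset.sum_comm]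
    simp only [mul_comm]
  have hadd : 0 ≤ ∑ i, ∑ j, c i * c j * ⟪F (y i), y i - y j⟫
      + ∑ i, ∑ j, c i * c j * ⟪F (y j), y j - y i⟫ := by
    simp only [← Finset.sum_add_distrib]
    refine Finset.sum_nonneg fun i _ => Finset.sum_nonneg fun j _ => ?_
    have hij : c i * c j * ⟪F (y i), y i - y j⟫ + c i * c j * ⟪F (y j), y j - y i⟫
        = c i * c j * ⟪F (y i) - F (y j), y i - y j⟫ := by
      rw [← neg_sub (y i) (y j), inner_neg_right, inner_sub_left]
      ring
    rw [hij]
    exact mul_nonneg (mul_nonneg (hc i) (hc j)) (hF _ (hy i) _ (hy j))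
  linarith

/-- Finitely many Minty inequalities of a monotone map have a common solution. -/
lemma exists_forall_inner_nonneg_of_fintype {ι : Type*} [Fintype ι]
    (hXne : X.Nonempty) (hXcomp : IsCompact X) (hXconv : Convex ℝ X)
    (hF : ∀ x ∈ X, ∀ y ∈ X, 0 ≤ ⟪F x - F y, x - y⟫)
    {y : ι → E} (hy : ∀ i, y i ∈ X) :
    ∃ x ∈ X, ∀ i, 0 ≤ ⟪F (y i), y i - x⟫ := by
  classical
  by_contra! hno
  let G : E → ι → ℝ := fun x i => ⟪F (y i), y i - x⟫
  have hGcont : Continuous G := by fun_prop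
  have hGconv : Convex ℝ (G '' X) := by
    rintro _ ⟨x, hx, rfl⟩ _ ⟨z, hz, rfl⟩ a b ha hb hab
    refine ⟨a • x + b • z, hXconv hx hz ha hb hab, ?_⟩
    ext i
    simp only [G, Pi.add_apply, Pi.smul_apply, smul_eq_mul, inner_sub_right, inner_add_right,
      inner_smul_right]
    linear_combination (-⟪F (y i), y i⟫) * hab
  have hdisj : Disjoint (G '' X) (Set.Ici (0 : ι → ℝ)) := by
    rw [Set.disjoint_left]
    rintro _ ⟨x, hx, rfl⟩ hpos
    obtain ⟨i, hi⟩ := hno x hx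
    exact absurd (hpos i) (not_le.mpr hi)
  obtain ⟨f, u, v, hfu, huv, hvf⟩ := geometric_hahn_banach_compact_closed hGconv
    (hXcomp.image hGcont) (convex_Ici (𝕜 := ℝ) (0 : ι → ℝ)) isClosed_Ici hdisj
  have hv : v < 0 := by simpa using hvf 0 (Set.mem_Ici.mpr le_rfl)
  let c : ι → ℝ := fun i => f (Pi.single i 1)
  have hfc : ∀ w : ι → ℝ, f w = ∑ i, c i * w i := by
    intro w
    conv_lhs => rw [pi_eq_sum_univ' w]
    simp [c, map_sum, mul_comm, Pi.single]
  have hc : ∀ i, 0 ≤ c i := by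
    intro i
    by_contra! hi
    have hmem : (v / c i) • (Pi.single i 1 : ι → ℝ) ∈ Set.Ici (0 : ι → ℝ) :=
      Set.mem_Ici.mpr <|
        smul_nonneg (div_nonneg_of_nonpos hv.le hi.le) (Pi.single_nonneg.mpr zero_le_one)
    have h := hvf _ hmem
    rw [map_smul, smul_eq_mul, show f (Pi.single i 1) = c i from rfl,
      div_mul_cancel₀ _ hi.ne] at h
    exact lt_irrefl _ h
  have hneg : ∀ x ∈ X, ∑ i, c i * ⟪F (y i), y i - x⟫ < 0 := by
    intro x hx
    have h := hfu _ (Set.mem_image_of_mem G hx)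
    rw [hfc] at h
    exact h.trans (huv.trans hv)
  have hsum : 0 < ∑ i, c i := by
    refine (Finset.sum_nonneg fun i _ => hc i).lt_of_ne fun h0 => ?_
    have hc0 := (Finset.sum_eq_zero_iff_of_nonneg fun i _ => hc i).mp h0.symm
    obtain ⟨x, hx⟩ := hXne
    have h := hneg x hx
    rw [Finset.sum_eq_zero fun i hi => by rw [hc0 i hi, zero_mul]] at h
    exact lt_irrefl _ h
  have hbar := hneg _ (hXconv.centerMass_mem (fun i _ => hc i) hsum fun i _ => hy i)
  have hcm : (∑ i, c i) * ∑ i, c i * ⟪F (y i), y i - Finset.univ.centerMass c y⟫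
      = ∑ i, ∑ j, c i * c j * ⟪F (y i), y i - y j⟫ := by
    rw [Finset.mul_sum]
    refine Finset.sum_congr rfl fun i _ => ?_
    simp only [mul_assoc, ← Finset.mul_sum]
    rw [mul_left_comm]
    congr 1
    simp only [Finset.centerMass, inner_sub_right, inner_smul_right, inner_sum, mul_sub,
      Finset.sum_sub_distrib, ← Finset.sum_mul, mul_inv_cancel_left₀ hsum.ne']
  exact absurd (sum_sum_inner_nonneg_of_monotone hF hy hc)
    (not_le.mpr (hcm ▸ mul_neg_of_pos_of_neg hsum hbar))

/-- A monotone map on a nonempty compact convex set has a solution of the Minty variational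
inequality. -/
lemma exists_minty_solution
    (hXne : X.Nonempty) (hXcomp : IsCompact X) (hXconv : Convex ℝ X)
    (hF : ∀ x ∈ X, ∀ y ∈ X, 0 ≤ ⟪F x - F y, x - y⟫) :
    ∃ x ∈ X, ∀ y ∈ X, 0 ≤ ⟪F y, y - x⟫ := by
  obtain ⟨x, hx, hxy⟩ := hXcomp.inter_iInter_nonempty
    (fun y : X => {x | 0 ≤ ⟪F y, (y : E) - x⟫})
    (fun y => isClosed_le continuous_const (by fun_prop)) (fun s => by
      obtain ⟨x, hx, h⟩ := exists_forall_inner_nonneg_of_fintype hXne hXcomp hXconv hF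
        (y := fun i : s => ((i : X) : E)) fun i => (i : X).2
      exact ⟨x, hx, Set.mem_iInter₂.mpr fun i hi => h ⟨i, hi⟩⟩)
  exact ⟨x, hx, fun y hy => Set.mem_iInter.mp hxy ⟨y, hy⟩⟩

/-- For continuous `F`, a Minty solution solves the variational inequality. -/
lemma inner_nonneg_of_minty (hXconv : Convex ℝ X) (hFcont : ContinuousOn F X)
    {x : E} (hx : x ∈ X) (hminty : ∀ y ∈ X, 0 ≤ ⟪F y, y - x⟫) {z : E} (hz : z ∈ X) :
    0 ≤ ⟪F x, z - x⟫ := by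
  have hmem : ∀ t ∈ Set.Ioc (0 : ℝ) 1, x + t • (z - x) ∈ X := fun t ht =>
    hXconv.add_smul_sub_mem hx hz ⟨ht.1.le, ht.2⟩
  have hIoc : Set.Ioc (0 : ℝ) 1 ∈ nhdsWithin 0 (Set.Ioi 0) := Ioc_mem_nhdsGT zero_lt_one
  have hpath : Filter.Tendsto (fun t : ℝ => x + t • (z - x)) (nhdsWithin 0 (Set.Ioi 0))
      (nhdsWithin x X) := by
    refine tendsto_nhdsWithin_iff.mpr ⟨?_, Filter.mem_of_superset hIoc hmem⟩
    have hcont : Continuous fun t : ℝ => x + t • (z - x) := by fun_prop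
    simpa using (hcont.tendsto 0).mono_left nhdsWithin_le_nhds
  refine ge_of_tendsto (((hFcont x hx).tendsto.comp hpath).inner tendsto_const_nhds)
    (Filter.mem_of_superset hIoc fun t ht => ?_)
  have h := hminty _ (hmem t ht)
  rw [add_sub_cancel_left, inner_smul_right] at h
  exact nonneg_of_mul_nonneg_right h ht.1

end MintyLemma

/-- On a nonempty compact convex set X, a continuous strictly
monotone map F admits exactly one solution of the variational inequality
⟪F(x*), x − x*⟫ ≥ 0 for all x ∈ X. -/
theorem stmt17 {n : ℕ}
    (X : Set (EuclideanSpace ℝ (Fin n)))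
    (hXne : X.Nonempty) (hXcomp : IsCompact X) (hXconv : Convex ℝ X)
    (F : EuclideanSpace ℝ (Fin n) → EuclideanSpace ℝ (Fin n))
    (hFcont : ContinuousOn F X)
    (hFmono : ∀ x ∈ X, ∀ y ∈ X, x ≠ y → 0 < ⟪F x - F y, x - y⟫) :
    ∃! xStar, xStar ∈ X ∧ ∀ x ∈ X, 0 ≤ ⟪F xStar, x - xStar⟫ := by
  have hmono : ∀ x ∈ X, ∀ y ∈ X, 0 ≤ ⟪F x - F y, x - y⟫ := by
    intro x hx y hy
    rcases eq_or_ne x y with rfl | hxy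
    · simp
    · exact (hFmono x hx y hy hxy).le
  obtain ⟨x, hx, hminty⟩ := exists_minty_solution hXne hXcomp hXconv hmono
  refine ⟨x, ⟨hx, fun z hz => inner_nonneg_of_minty hXconv hFcont hx hminty hz⟩, ?_⟩
  rintro y ⟨hy, hysol⟩
  by_contra hne
  have hpos := hFmono y hy x hx hne
  have hyx := hysol x hx
  have hxy := inner_nonneg_of_minty hXconv hFcont hx hminty hy
  rw [inner_sub_left] at hpos
  rw [← neg_sub y x, inner_neg_right] at hyx
  linarith
end
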